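/- Let a, b ∈ ℝ∖{0} and let W be the 2×2 weight matrix on ℝ given by W(x) = e^{−x²}·[[a²x² + e^{2bx}, ax],[ax, 1]]. Then for every good-enough scalar weight w supported on ℝ, the modules D(w, W) and D(W, w) are zero; that is, the only 1×2 matrix differential operator T with polynomial coefficients satisfying p_n·T = A_n·P_n for all n ≥ 0 (for some 1×2 matrices A_n) is T = 0, and the only 2×1 matrix differential operator S with polynomial coefficients satisfying P_n·S = B_n·p_n for all n ≥ 0 is S = 0, where {p_n} is a sequence of orthogonal polynomials for w and {P_n} a MOP sequence for W. -/

import Mathlib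

open MeasureTheory Filter Polynomial Matrix
open scoped ComplexOrder

noncomputable section

/-- A matrix polynomial. -/
abbrev MatPoly (n m : ℕ) := Matrix (Fin n) (Fin m) (Polynomial ℂ)

/-- Evaluation of a matrix polynomial at a real point. -/
def evalM {n m : ℕ} (P : MatPoly n m) (x : ℝ) : Matrix (Fin n) (Fin m) ℂ :=
  Matrix.of fun i j => (P i j).eval (x : ℂ)

/-- Entrywise `j`-th derivative of a matrix polynomial. -/
def derivM {n m : ℕ} (j : ℕ) (P : MatPoly n m) : MatPoly n m :=
  Matrix.of fun i k => (⇑Polynomial.derivative)^[j] (P i k)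

/-- A constant matrix, viewed as a matrix polynomial. -/
def cmap {n m : ℕ} (A : Matrix (Fin n) (Fin m) ℂ) : MatPoly n m :=
  A.map Polynomial.C

/-- A matrix differential operator with polynomial coefficients,
`D = ∑_{j ≤ order} ∂^j F_j`, acting on the right. -/
structure MatDiffOp (n m : ℕ) where
  order : ℕ
  coeff : ℕ → MatPoly n m
  coeff_eq_zero : ∀ j, order < j → coeff j = 0

/-- The right action `(P · D)(x) = ∑_j P^{(j)}(x) F_j(x)`. -/
def MatDiffOp.act {k n m : ℕ} (P : MatPoly k n) (D : MatDiffOp n m) : MatPoly k m :=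
  ∑ j ∈ Finset.range (D.order + 1), derivM j P * D.coeff j

/-- The action `f · D = ∑_j f^{(j)} F_j` on a scalar polynomial. -/
def MatDiffOp.sact {n m : ℕ} (D : MatDiffOp n m) (f : Polynomial ℂ) : MatPoly n m :=
  ∑ j ∈ Finset.range (D.order + 1), ((⇑Polynomial.derivative)^[j] f) • D.coeff j

/-- A weight matrix on the set `s`: smooth, a.e. positive definite, with finite moments. -/
structure IsWeight (s : Set ℝ) {N : ℕ} (W : ℝ → Matrix (Fin N) (Fin N) ℂ) : Prop where
  smooth : ∀ i j, ContDiffOn ℝ (⊤ : ℕ∞) (fun x => W x i j) s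
  posdef : ∀ᵐ x ∂(volume.restrict s), (W x).PosDef
  moments : ∀ (k : ℕ) (i j : Fin N), IntegrableOn (fun x : ℝ => (x : ℂ) ^ k * W x i j) s

/-- `∑_j W^{(j)}(x) F_j(x)` for a differential operator `D` with coefficients `F_j`. -/
def weightSide {N : ℕ} (W : ℝ → Matrix (Fin N) (Fin N) ℂ) (D : MatDiffOp N N) (x : ℝ) :
    Matrix (Fin N) (Fin N) ℂ :=
  ∑ j ∈ Finset.range (D.order + 1),
    (Matrix.of fun i k => iteratedDeriv j (fun t => W t i k) x) * evalM (D.coeff j) x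

/-- The weight `W` is good enough. -/
def GoodEnough (s : Set ℝ) {N : ℕ} (W : ℝ → Matrix (Fin N) (Fin N) ℂ) : Prop :=
  ∀ (A : MatPoly N N) (D : MatDiffOp N N),
    (∀ (P : MatPoly N N) (i j : Fin N),
        IntegrableOn (fun x => (evalM P x * (evalM A x * W x)) i j) s ∧
        IntegrableOn (fun x => (evalM P x * weightSide W D x) i j) s ∧
        ∫ x in s, (evalM P x * (evalM A x * W x)) i j =
          ∫ x in s, (evalM P x * weightSide W D x) i j) →
    ∀ x ∈ s, evalM A x * W x = weightSide W D x

/-- The matrix inner product `⟨P, Q⟩_W = ∫ P W Q^*`. -/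
def innerW (s : Set ℝ) {N a b : ℕ} (W : ℝ → Matrix (Fin N) (Fin N) ℂ)
    (P : MatPoly a N) (Q : MatPoly b N) : Matrix (Fin a) (Fin b) ℂ :=
  Matrix.of fun i j => ∫ x in s, (evalM P x * W x * (evalM Q x)ᴴ) i j

/-- A sequence of matrix orthogonal polynomials with respect to `W` on `s`. -/
structure IsMOP (s : Set ℝ) {N : ℕ} (W : ℝ → Matrix (Fin N) (Fin N) ℂ)
    (P : ℕ → MatPoly N N) : Prop where
  degree_le : ∀ n (i j : Fin N), ((P n) i j).natDegree ≤ n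
  lead_unit : ∀ n, IsUnit (Matrix.of fun i j : Fin N => ((P n) i j).coeff n)
  integrable : ∀ n m (i j : Fin N),
    IntegrableOn (fun x => (evalM (P n) x * W x * (evalM (P m) x)ᴴ) i j) s
  orthogonal : ∀ n m, n ≠ m → innerW s W (P n) (P m) = 0

/-- Membership in the algebra `𝒟(W)` (relative to the MOP sequence `P`). -/
def InDW {N : ℕ} (P : ℕ → MatPoly N N) (D : MatDiffOp N N) : Prop :=
  ∀ n, ∃ Λ : Matrix (Fin N) (Fin N) ℂ, MatDiffOp.act (P n) D = cmap Λ * P n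

/-- Membership in the module `𝒟(W, W̃)` (relative to the MOP sequences `P`, `Q`). -/
def InDWW {N1 N2 : ℕ} (P : ℕ → MatPoly N1 N1) (Q : ℕ → MatPoly N2 N2)
    (T : MatDiffOp N1 N2) : Prop :=
  ∀ n, ∃ A : Matrix (Fin N1) (Fin N2) ℂ, MatDiffOp.act (P n) T = cmap A * Q n

/-- A matrix polynomial has degree (exactly) `d`. -/
def hasDeg {n m : ℕ} (P : MatPoly n m) (d : ℕ) : Prop :=
  (∀ i j, (P i j).degree ≤ (d : WithBot ℕ)) ∧ ∃ i j, (P i j).degree = (d : WithBot ℕ)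

/-- A degree-preserving differential operator. -/
def DegreePreserving {n m : ℕ} (D : MatDiffOp n m) : Prop :=
  ∀ᶠ d in (atTop : Filter ℕ), ∀ f : Polynomial ℂ, f.degree = ((d : ℕ) : WithBot ℕ) → hasDeg (D.sact f) d

/-- `Q` is a Darboux transformation of `P`. -/
def IsDarboux {N : ℕ} (P Q : ℕ → MatPoly N N) : Prop :=
  ∃ (V Nop D : MatDiffOp N N) (A : ℕ → Matrix (Fin N) (Fin N) ℂ),
    DegreePreserving V ∧ DegreePreserving Nop ∧
    (∀ R : MatPoly N N, MatDiffOp.act R D = MatDiffOp.act (MatDiffOp.act R V) Nop) ∧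
    InDW P D ∧
    (∀ n, MatDiffOp.act (P n) V = cmap (A n) * Q n)

/-! ### Vector polynomials of bounded degree -/

/-- Complex conjugation of the coefficients of a polynomial. -/
def conjPoly : ℂ[X] →+* ℂ[X] := Polynomial.mapRingHom (starRingEnd ℂ)

lemma conjPoly_conjPoly (p : ℂ[X]) : conjPoly (conjPoly p) = p := by
  ext n; simp [conjPoly]

lemma conjPoly_ne_zero {p : ℂ[X]} (hp : p ≠ 0) : conjPoly p ≠ 0 := fun h =>
  hp (by rw [← conjPoly_conjPoly p, h, map_zero])

lemma eval_conjPoly (p : ℂ[X]) (x : ℝ) :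
    (conjPoly p).eval (x : ℂ) = star (p.eval (x : ℂ)) := by
  have h := Polynomial.eval_map_apply (f := starRingEnd ℂ) (p := p) (x : ℂ)
  simpa [conjPoly] using h

lemma conjPoly_mem_degreeLT {p : ℂ[X]} {m : ℕ} (hp : p ∈ degreeLT ℂ m) :
    conjPoly p ∈ degreeLT ℂ m := by
  rw [mem_degreeLT] at hp ⊢
  exact lt_of_le_of_lt (by simp [conjPoly]) hp

/-- Vectors of polynomials of degree less than `m`. -/
def vecDegreeLT (N m : ℕ) : Submodule ℂ (Fin N → ℂ[X]) :=
  Submodule.pi Set.univ fun _ => degreeLT ℂ m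

lemma mem_vecDegreeLT {N m : ℕ} {v : Fin N → ℂ[X]} :
    v ∈ vecDegreeLT N m ↔ ∀ i, v i ∈ degreeLT ℂ m := by
  simp [vecDegreeLT, Submodule.mem_pi]

lemma conj_mem_vecDegreeLT {N m : ℕ} {v : Fin N → ℂ[X]} (hv : v ∈ vecDegreeLT N m) :
    (fun i => conjPoly (v i)) ∈ vecDegreeLT N m :=
  mem_vecDegreeLT.2 fun i => conjPoly_mem_degreeLT (mem_vecDegreeLT.1 hv i)

lemma exists_mem_vecDegreeLT {N : ℕ} (v : Fin N → ℂ[X]) : ∃ m, v ∈ vecDegreeLT N m := by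
  refine ⟨(Finset.univ.sup fun i => (v i).natDegree) + 1, mem_vecDegreeLT.2 fun i => ?_⟩
  rw [mem_degreeLT]
  refine lt_of_le_of_lt Polynomial.degree_le_natDegree ?_
  have := Finset.le_sup (f := fun i => (v i).natDegree) (Finset.mem_univ i)
  exact_mod_cast Nat.lt_succ_of_le this

/-- A sequence of matrix polynomials `P n` of degree `n` with invertible leading coefficient. -/
structure IsSimpleSeq {N : ℕ} (P : ℕ → Fin N → Fin N → ℂ[X]) : Prop where
  natDegree_le : ∀ n i j, (P n i j).natDegree ≤ n
  lead_unit : ∀ n, IsUnit (Matrix.of fun i j : Fin N => (P n i j).coeff n)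

namespace IsSimpleSeq

variable {N : ℕ} {P : ℕ → Fin N → Fin N → ℂ[X]}

lemma row_mem (hP : IsSimpleSeq P) (n : ℕ) (i : Fin N) : P n i ∈ vecDegreeLT N (n + 1) := by
  refine mem_vecDegreeLT.2 fun j => ?_
  rw [mem_degreeLT]
  refine lt_of_le_of_lt Polynomial.degree_le_natDegree ?_
  exact_mod_cast Nat.lt_succ_of_le (hP.natDegree_le n i j)

lemma conj (hP : IsSimpleSeq P) : IsSimpleSeq fun n i j => conjPoly (P n i j) where
  natDegree_le n i j := by
    refine le_trans ?_ (hP.natDegree_le n i j)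
    simp [conjPoly]
  lead_unit n := by
    have := (hP.lead_unit n).map (RingHom.mapMatrix (starRingEnd ℂ))
    convert this using 1
    ext i j
    simp [conjPoly]

lemma mem_span (hP : IsSimpleSeq P) {m : ℕ} {v : Fin N → ℂ[X]} (hv : v ∈ vecDegreeLT N m) :
    v ∈ Submodule.span ℂ {r | ∃ n < m, ∃ i, P n i = r} := by
  induction m generalizing v with
  | zero =>
    have : v = 0 := by
      ext1 i
      have := mem_vecDegreeLT.1 hv i
      rw [mem_degreeLT] at this
      simpa using this
    rw [this]; exact Submodule.zero_mem _
  | succ m ih =>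
    set M : Matrix (Fin N) (Fin N) ℂ := Matrix.of fun i j => (P m i j).coeff m with hM
    set c : Fin N → ℂ := (fun j => (v j).coeff m) ᵥ* M⁻¹ with hc
    have hcM : c ᵥ* M = fun j => (v j).coeff m := by
      rw [hc, Matrix.vecMul_vecMul,
        Matrix.nonsing_inv_mul _ ((Matrix.isUnit_iff_isUnit_det _).1 (hP.lead_unit m)),
        Matrix.vecMul_one]
    have hmem : v - ∑ i, c i • P m i ∈ vecDegreeLT N m := by
      have h1 : v - ∑ i, c i • P m i ∈ vecDegreeLT N (m + 1) :=
        Submodule.sub_mem _ hv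
          (Submodule.sum_mem _ fun i _ => Submodule.smul_mem _ _ (hP.row_mem m i))
      refine mem_vecDegreeLT.2 fun j => ?_
      have h2 := mem_vecDegreeLT.1 h1 j
      rw [mem_degreeLT] at h2 ⊢
      rw [Polynomial.degree_lt_iff_coeff_zero] at h2 ⊢
      intro k hk
      rcases hk.eq_or_lt with rfl | hk
      · have := congrFun hcM j
        simp only [Matrix.vecMul, dotProduct, hM, Matrix.of_apply] at this
        simp [Finset.sum_apply, this]
      · exact h2 k hk
    have hmono : Submodule.span ℂ {r | ∃ n < m, ∃ i, P n i = r} ≤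
        Submodule.span ℂ {r | ∃ n < m + 1, ∃ i, P n i = r} :=
      Submodule.span_mono fun r ⟨n, hn, i, hi⟩ => ⟨n, by omega, i, hi⟩
    rw [← sub_add_cancel v (∑ i, c i • P m i)]
    exact Submodule.add_mem _ (hmono (ih hmem)) (Submodule.sum_mem _ fun i _ =>
      Submodule.smul_mem _ _ (Submodule.subset_span ⟨m, by omega, i, rfl⟩))

lemma span_eq (hP : IsSimpleSeq P) (m : ℕ) :
    Submodule.span ℂ {r | ∃ n < m, ∃ i, P n i = r} = vecDegreeLT N m := by
  refine le_antisymm (Submodule.span_le.2 ?_) fun v hv => hP.mem_span hv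
  rintro _ ⟨n, hn, i, rfl⟩
  exact mem_vecDegreeLT.2 fun j =>
    degreeLT_mono (by omega : n + 1 ≤ m) (mem_vecDegreeLT.1 (hP.row_mem n i) j)

lemma finiteDimensional (hP : IsSimpleSeq P) (m : ℕ) :
    FiniteDimensional ℂ (vecDegreeLT N m) := by
  rw [← hP.span_eq m]
  refine FiniteDimensional.span_of_finite ℂ (Set.Finite.subset
    ((Set.finite_Iio m).image2 (fun n i => P n i) (Set.finite_univ (α := Fin N))) ?_)
  rintro _ ⟨n, hn, i, rfl⟩
  exact ⟨n, hn, i, trivial, rfl⟩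

/-- Linear maps that agree on all rows of a simple sequence are equal. -/
lemma linearMap_ext (hP : IsSimpleSeq P) {M : Type*} [AddCommGroup M] [Module ℂ M]
    {f g : (Fin N → ℂ[X]) →ₗ[ℂ] M} (h : ∀ n i, f (P n i) = g (P n i)) : f = g := by
  refine LinearMap.ext fun v => ?_
  obtain ⟨m, hm⟩ := exists_mem_vecDegreeLT v
  exact LinearMap.eqOn_span (s := {r | ∃ n < m, ∃ i, P n i = r})
    (by rintro _ ⟨n, -, i, rfl⟩; exact h n i) (hP.mem_span hm)

end IsSimpleSeq

/-- A simple sequence `P`, orthogonal for the definite bilinear form `B`, where orthogonality is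
taken against the conjugates. -/
structure IsOrthoSeq {N : ℕ} (B : (Fin N → ℂ[X]) →ₗ[ℂ] (Fin N → ℂ[X]) →ₗ[ℂ] ℂ)
    (P : ℕ → Fin N → Fin N → ℂ[X]) : Prop where
  simple : IsSimpleSeq P
  definite : ∀ v, B v (fun i => conjPoly (v i)) = 0 → v = 0
  ortho : ∀ n m, n ≠ m → ∀ i k, B (P n i) (fun j => conjPoly (P m k j)) = 0

namespace IsOrthoSeq

variable {N : ℕ} {B : (Fin N → ℂ[X]) →ₗ[ℂ] (Fin N → ℂ[X]) →ₗ[ℂ] ℂ}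
  {P : ℕ → Fin N → Fin N → ℂ[X]}

lemma apply_eq_zero (hP : IsOrthoSeq B P) {n : ℕ} (i : Fin N) {v : Fin N → ℂ[X]}
    (hv : v ∈ vecDegreeLT N n) : B (P n i) v = 0 := by
  have := LinearMap.eqOn_span (f := B (P n i)) (g := 0) (s := _)
    (by rintro _ ⟨m, hm, k, rfl⟩; exact hP.ortho n m (by omega) i k) (hP.simple.conj.mem_span hv)
  simpa using this

/-- A functional that vanishes on the rows of `P n` for `n ≥ m` is represented by a vector
polynomial of degree less than `m`. -/
lemma exists_repr (hP : IsOrthoSeq B P) {m : ℕ} (L : (Fin N → ℂ[X]) →ₗ[ℂ] ℂ)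
    (hL : ∀ n, m ≤ n → ∀ i, L (P n i) = 0) : ∃ g ∈ vecDegreeLT N m, ∀ v, L v = B v g := by
  have := hP.simple.finiteDimensional m
  let V := vecDegreeLT N m
  let Φ : V →ₗ[ℂ] Module.Dual ℂ V :=
    { toFun := fun g => (B.flip g).domRestrict V
      map_add' := fun g h => by ext; simp
      map_smul' := fun c g => by ext; simp }
  have hinj : Function.Injective Φ := by
    rw [← LinearMap.ker_eq_bot, LinearMap.ker_eq_bot']
    intro g hg
    have h1 : B (fun i => conjPoly (g.1 i)) g.1 = 0 :=
      LinearMap.congr_fun hg ⟨fun i => conjPoly (g.1 i), conj_mem_vecDegreeLT g.2⟩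
    have h2 : (fun i => conjPoly (g.1 i)) = 0 := hP.definite _ (by
      simpa only [conjPoly_conjPoly] using h1)
    ext1
    funext i
    by_contra h
    exact conjPoly_ne_zero h (congrFun h2 i)
  have hsurj : Function.Surjective Φ :=
    (LinearMap.injective_iff_surjective_of_finrank_eq_finrank
      Subspace.dual_finrank_eq.symm).1 hinj
  obtain ⟨g, hg⟩ := hsurj (L.domRestrict V)
  refine ⟨g.1, g.2, fun v => ?_⟩
  have : L = B.flip g.1 := hP.simple.linearMap_ext fun n i => by
    rcases lt_or_ge n m with hn | hn
    · have hmem : P n i ∈ V := by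
        have : P n i ∈ Submodule.span ℂ {r | ∃ n < m, ∃ i, P n i = r} :=
          Submodule.subset_span ⟨n, hn, i, rfl⟩
        rwa [hP.simple.span_eq] at this
      exact (LinearMap.congr_fun hg ⟨P n i, hmem⟩).symm
    · rw [hL n hn i]
      refine (hP.apply_eq_zero i (mem_vecDegreeLT.2 fun j => ?_)).symm
      exact degreeLT_mono hn (mem_vecDegreeLT.1 g.2 j)
  rw [this]; rfl

end IsOrthoSeq

/-! ### Differential operators of finite order -/

/-- The commutator of a linear map with multiplication by `X`. -/
def commX {M M₂ : Type*} [AddCommGroup M] [AddCommGroup M₂] [Module ℂ[X] M] [Module ℂ[X] M₂]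
    [Module ℂ M] [Module ℂ M₂] [IsScalarTower ℂ ℂ[X] M] [IsScalarTower ℂ ℂ[X] M₂]
    (T : M →ₗ[ℂ] M₂) : M →ₗ[ℂ] M₂ :=
  T ∘ₗ Module.toModuleEnd ℂ (S := ℂ[X]) M X - Module.toModuleEnd ℂ (S := ℂ[X]) M₂ X ∘ₗ T

/-- `T` is annihilated by the `k`-fold commutator with multiplication by `X`. -/
def IsDiffOp {M M₂ : Type*} [AddCommGroup M] [AddCommGroup M₂] [Module ℂ[X] M] [Module ℂ[X] M₂]
    [Module ℂ M] [Module ℂ M₂] [IsScalarTower ℂ ℂ[X] M] [IsScalarTower ℂ ℂ[X] M₂]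
    (k : ℕ) (T : M →ₗ[ℂ] M₂) : Prop :=
  commX^[k] T = 0

section
variable {M M₂ : Type*} [AddCommGroup M] [AddCommGroup M₂] [Module ℂ[X] M] [Module ℂ[X] M₂]
    [Module ℂ M] [Module ℂ M₂] [IsScalarTower ℂ ℂ[X] M] [IsScalarTower ℂ ℂ[X] M₂]

lemma commX_apply (T : M →ₗ[ℂ] M₂) (v : M) :
    commX T v = T ((X : ℂ[X]) • v) - (X : ℂ[X]) • T v := rfl

lemma isDiffOp_zero {T : M →ₗ[ℂ] M₂} : IsDiffOp 0 T ↔ T = 0 := Iff.rfl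

lemma isDiffOp_succ {k : ℕ} {T : M →ₗ[ℂ] M₂} : IsDiffOp (k + 1) T ↔ IsDiffOp k (commX T) := Iff.rfl

end

/-- The scalar operator `∑_{j < k} ∂^j F_j`. -/
def diffSum (k : ℕ) (F : ℕ → ℂ[X]) : ℂ[X] →ₗ[ℂ] ℂ[X] :=
  ∑ j ∈ Finset.range k, LinearMap.mulRight ℂ (F j) ∘ₗ (Polynomial.derivative ^ j : ℂ[X] →ₗ[ℂ] ℂ[X])

lemma diffSum_apply (k : ℕ) (F : ℕ → ℂ[X]) (p : ℂ[X]) :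
    diffSum k F p = ∑ j ∈ Finset.range k, (⇑Polynomial.derivative)^[j] p * F j := by
  simp [diffSum, Module.End.pow_apply]

lemma commX_diffSum (k : ℕ) (F : ℕ → ℂ[X]) :
    commX (diffSum (k + 1) F) = diffSum k fun j => ((j : ℂ[X]) + 1) * F (j + 1) := by
  refine LinearMap.ext fun p => ?_
  rw [commX_apply, diffSum_apply, diffSum_apply, diffSum_apply, smul_eq_mul, smul_eq_mul,
    Finset.mul_sum, ← Finset.sum_sub_distrib, Finset.sum_range_succ']
  simp only [Function.iterate_zero, id_eq]
  rw [mul_assoc, sub_self, add_zero]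
  refine Finset.sum_congr rfl fun j _ => ?_
  rw [mul_comm X p, iterate_derivative_mul_X]
  simp only [Nat.add_sub_cancel, nsmul_eq_mul]
  push_cast
  ring

lemma isDiffOp_diffSum (k : ℕ) (F : ℕ → ℂ[X]) : IsDiffOp k (diffSum k F) := by
  induction k generalizing F with
  | zero => simp [isDiffOp_zero, diffSum]
  | succ k ih => rw [isDiffOp_succ, commX_diffSum]; exact ih _

lemma IsDiffOp.exists_diffSum {k : ℕ} {T : ℂ[X] →ₗ[ℂ] ℂ[X]} (hT : IsDiffOp k T) :
    ∃ F, T = diffSum k F := by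
  induction k generalizing T with
  | zero => exact ⟨0, by rw [isDiffOp_zero.1 hT]; simp [diffSum]⟩
  | succ k ih =>
    obtain ⟨G, hG⟩ := ih (isDiffOp_succ.1 hT)
    set F : ℕ → ℂ[X] := fun j => if j = 0 then T 1 else C (1 / (j : ℂ)) * G (j - 1) with hF
    refine ⟨F, ?_⟩
    have hcomm : commX (diffSum (k + 1) F) = commX T := by
      rw [commX_diffSum, hG]
      congr 1
      funext j
      have hj : (j : ℂ) + 1 ≠ 0 := by exact_mod_cast j.succ_ne_zero
      have : (j : ℂ[X]) + 1 = C ((j : ℂ) + 1) := by simp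
      simp only [hF, Nat.succ_ne_zero, if_false, Nat.add_sub_cancel]
      rw [this, ← mul_assoc, ← C_mul]
      push_cast
      rw [mul_one_div_cancel hj]
      simp
    have hone : diffSum (k + 1) F 1 = T 1 := by
      rw [diffSum_apply, Finset.sum_range_succ']
      simp [hF]
    refine LinearMap.ext fun p => ?_
    induction p using Polynomial.induction_on' with
    | add p q hp hq => rw [map_add, map_add, hp, hq]
    | monomial n c =>
      rw [← mul_one c, ← smul_eq_mul, ← Polynomial.smul_monomial, map_smul, map_smul]
      congr 1
      induction n with
      | zero => exact hone.symm
      | succ n ihn =>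
        have h := LinearMap.congr_fun hcomm (monomial n 1)
        rw [commX_apply, commX_apply, ihn, smul_eq_mul, X_mul_monomial] at h
        exact (sub_left_inj.1 h).symm

lemma diffSum_injective {k : ℕ} {F : ℕ → ℂ[X]} (h : diffSum k F = 0) : ∀ j < k, F j = 0 := by
  intro j
  induction j using Nat.strong_induction_on with
  | _ j ih =>
    intro hj
    have h1 := LinearMap.congr_fun h (X ^ j)
    rw [diffSum_apply, Finset.sum_eq_single_of_mem j (Finset.mem_range.2 hj)] at h1
    · rw [iterate_derivative_X_pow_eq_smul] at h1
      have h2 : (j.descFactorial j : ℂ) ≠ 0 := by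
        rw [Nat.descFactorial_self]; exact_mod_cast j.factorial_ne_zero
      simpa [Nat.descFactorial_self, j.factorial_ne_zero] using h1
    · intro i hi hij
      rcases lt_or_gt_of_ne hij with hlt | hgt
      · rw [ih i hlt (by omega), mul_zero]
      · rw [iterate_derivative_eq_zero (by simpa using hgt), zero_mul]

lemma dvd_diffSum {k : ℕ} (F : ℕ → ℂ[X]) (f p : ℂ[X]) : f ∣ diffSum k F (f ^ k * p) := by
  rw [diffSum_apply]
  refine Finset.dvd_sum fun j hj => Dvd.dvd.mul_right ?_ _
  have h := pow_sub_dvd_iterate_derivative_of_pow_dvd j (Dvd.intro p rfl : f ^ k ∣ f ^ k * p)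
  have hj' := Finset.mem_range.1 hj
  exact (dvd_pow_self f (by omega)).trans h

/-! ### Positive functionals satisfying a Pearson equation -/

/-- A positive definite functional on polynomials. -/
structure IsPosFunctional (u : ℂ[X] →ₗ[ℂ] ℂ) : Prop where
  nonneg : ∀ p, 0 ≤ u (p * conjPoly p)
  definite : ∀ p, u (p * conjPoly p) = 0 → p = 0

lemma IsPosFunctional.eq_zero {u : ℂ[X] →ₗ[ℂ] ℂ} (hu : IsPosFunctional u) {q : ℂ[X]}
    (h : ∀ p, u (p * q) = 0) : q = 0 :=
  hu.definite q (by rw [mul_comm]; exact h _)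

/-- The functional satisfies the Pearson equation of the weight `e^{-x² + 2 b x}`. -/
def IsPearson (b : ℂ) (u : ℂ[X] →ₗ[ℂ] ℂ) : Prop :=
  ∀ p, u (derivative p) = u ((2 * X - 2 * C b) * p)

namespace IsPearson

variable {b : ℂ} {u : ℂ[X] →ₗ[ℂ] ℂ}

lemma apply_derivative_mul (hu : IsPearson b u) (p q : ℂ[X]) :
    u (derivative p * q) = u (p * ((2 * X - 2 * C b) * q - derivative q)) := by
  have h := hu (p * q)
  rw [derivative_mul, map_add] at h
  rw [mul_sub, map_sub, eq_sub_iff_add_eq, h]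
  congr 1
  ring

lemma exists_adjoint_iterate (hu : IsPearson b u) (j : ℕ) (q : ℂ[X]) :
    ∃ r, ∀ p, u ((⇑derivative)^[j] p * q) = u (p * r) := by
  induction j generalizing q with
  | zero => exact ⟨q, fun p => rfl⟩
  | succ j ih =>
    obtain ⟨r, hr⟩ := ih ((2 * X - 2 * C b) * q - derivative q)
    exact ⟨r, fun p => by rw [Function.iterate_succ_apply', hu.apply_derivative_mul, hr]⟩

lemma exists_adjoint (hu : IsPearson b u) {k : ℕ} {T : ℂ[X] →ₗ[ℂ] ℂ[X]} (hT : IsDiffOp k T)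
    (q : ℂ[X]) : ∃ r, ∀ p, u (T p * q) = u (p * r) := by
  obtain ⟨F, rfl⟩ := hT.exists_diffSum
  choose r hr using fun j => hu.exists_adjoint_iterate j (F j * q)
  refine ⟨∑ j ∈ Finset.range k, r j, fun p => ?_⟩
  rw [diffSum_apply, Finset.sum_mul, Finset.mul_sum, map_sum, map_sum]
  exact Finset.sum_congr rfl fun j _ => by rw [mul_assoc, hr]

/-- Functionals of Hermite type with different shifts are independent over the polynomials. -/
lemma independent {u₀ u₁ : ℂ[X] →ₗ[ℂ] ℂ} (hb : b ≠ 0) (h₀ : IsPearson 0 u₀) (h₁ : IsPearson b u₁)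
    (hpos : IsPosFunctional u₁) {r s : ℂ[X]} (h : ∀ p, u₀ (p * r) + u₁ (p * s) = 0) : s = 0 := by
  by_contra hs
  suffices ∀ k : ℕ, ∀ r s : ℂ[X], s ≠ 0 → (⇑derivative)^[k] r = 0 →
      (∀ p, u₀ (p * r) + u₁ (p * s) = 0) → False from
    this (r.natDegree + 1) r s hs (iterate_derivative_eq_zero (Nat.lt_succ_self _)) h
  clear h hs r s
  intro k
  induction k with
  | zero =>
    intro r s hs hr h
    simp only [Function.iterate_zero, id_eq] at hr
    exact hs (hpos.eq_zero fun p => by simpa [hr] using h p)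
  | succ k ih =>
    intro r s hs hr h
    refine ih (derivative r) (C (2 * b) * s + derivative s) ?_ (by
      rwa [← Function.iterate_succ_apply]) fun p => ?_
    · intro h0
      have hdeg : (derivative s).degree < (C (2 * b) * s).degree := by
        rw [degree_C_mul (mul_ne_zero two_ne_zero hb)]
        exact degree_derivative_lt hs
      have := degree_add_eq_left_of_degree_lt hdeg
      rw [h0, degree_zero, degree_C_mul (mul_ne_zero two_ne_zero hb), eq_comm, degree_eq_bot] at this
      exact hs this
    · have e1 := h (derivative p)
      have e2 := h (p * (2 * X))
      rw [h₀.apply_derivative_mul, h₁.apply_derivative_mul] at e1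
      have e3 : p * ((2 * X - 2 * C 0) * r - derivative r) = p * (2 * X) * r - p * derivative r := by
        simp; ring
      have e4 : p * ((2 * X - 2 * C b) * s - derivative s) =
          p * (2 * X) * s - p * (C (2 * b) * s + derivative s) := by
        rw [C_mul, map_ofNat]; ring
      rw [e3, e4, map_sub, map_sub] at e1
      linear_combination e2 - e1

end IsPearson

/-! ### The vanishing theorem for adjoint pairs -/

section Vanishing

variable {a b : ℂ} {u u₀ u₁ : ℂ[X] →ₗ[ℂ] ℂ} {p : ℕ → ℂ[X]} {T₁ T₂ : ℂ[X] →ₗ[ℂ] ℂ[X]} {k : ℕ}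

lemma eq_zero_of_apply_orthogonal_eq_zero (hu : IsPosFunctional u)
    (hortho : ∀ n, ∀ g ∈ degreeLT ℂ n, u (p n * g) = 0)
    (hspan : ∀ T : ℂ[X] →ₗ[ℂ] ℂ[X], (∀ n, T (p n) = 0) → T = 0)
    (hT : IsDiffOp k T₁) (h : ∀ n, T₁ (p (n + 1)) = 0) : T₁ = 0 := by
  refine hspan _ fun n => ?_
  rcases n with _ | n
  swap
  · exact h n
  by_contra hc
  have key : ∀ q, u (p 0) • T₁ q = u q • T₁ (p 0) := by
    intro q
    have := hspan (u (p 0) • T₁ - u.smulRight (T₁ (p 0))) fun n => by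
      rcases n with _ | n
      · simp
      · have h1 := hortho (n + 1) 1 (by
          rw [mem_degreeLT]; exact degree_one_le.trans_lt (by exact_mod_cast n.succ_pos))
        rw [mul_one] at h1
        simp [h n, h1]
    exact sub_eq_zero.1 (LinearMap.congr_fun this q)
  obtain ⟨t, ht⟩ : ∃ t, (T₁ (p 0)).eval t ≠ 0 := by
    by_contra! hall
    exact hc (Polynomial.funext fun t => by simpa using hall t)
  obtain ⟨F, rfl⟩ := hT.exists_diffSum
  have hX : (X - C t : ℂ[X]) ^ k ≠ 0 := pow_ne_zero _ (X_sub_C_ne_zero t)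
  refine hX (hu.eq_zero fun q => ?_)
  have h1 := congrArg (Polynomial.eval t) (key ((X - C t) ^ k * q))
  have h2 : (diffSum k F ((X - C t) ^ k * q)).eval t = 0 :=
    dvd_iff_isRoot.1 (dvd_diffSum F _ q)
  rw [eval_smul, eval_smul, h2, smul_zero, smul_eq_mul] at h1
  rw [mul_comm]
  exact (mul_eq_zero.1 h1.symm).resolve_right ht

/-- A differential operator `(T₁, T₂)` which preserves degrees together with its adjoint between
`u` and the form `u₀ ((a x f₁ + f₂) (a x g₁ + g₂)) + u₁ (f₁ g₁)` is zero. -/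
theorem pair_eq_zero (ha : a ≠ 0) (hb : b ≠ 0) (hu : IsPosFunctional u)
    (hu₀ : IsPosFunctional u₀) (hu₁ : IsPosFunctional u₁) (h₀ : IsPearson 0 u₀)
    (h₁ : IsPearson b u₁) (hp : ∀ n, p n ∈ degreeLT ℂ (n + 1))
    (hortho : ∀ n, ∀ g ∈ degreeLT ℂ n, u (p n * g) = 0)
    (hspan : ∀ T : ℂ[X] →ₗ[ℂ] ℂ[X], (∀ n, T (p n) = 0) → T = 0)
    (hT₁ : IsDiffOp k T₁) (hT₂ : IsDiffOp k T₂)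
    (hdeg₂ : ∀ m, ∀ q ∈ degreeLT ℂ m, T₂ q ∈ degreeLT ℂ m)
    (hadj : ∀ m, ∀ q₁ ∈ degreeLT ℂ m, ∀ q₂ ∈ degreeLT ℂ m, ∃ g ∈ degreeLT ℂ m, ∀ f,
      u₀ ((C a * X * T₁ f + T₂ f) * (C a * X * q₁ + q₂)) + u₁ (T₁ f * q₁) = u (f * g)) :
    T₁ = 0 ∧ T₂ = 0 := by
  have hex : ∀ q : ℂ[X], ∃ m, q ∈ degreeLT ℂ m := fun q => ⟨q.natDegree + 1, by
    rw [mem_degreeLT]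
    exact degree_le_natDegree.trans_lt (by exact_mod_cast Nat.lt_succ_self _)⟩
  have hadj₀ : ∀ q, ∃ r, ∀ f, u₀ ((C a * X * T₁ f + T₂ f) * q) = u₀ (f * r) := by
    intro q
    obtain ⟨r₁, hr₁⟩ := h₀.exists_adjoint hT₁ (C a * X * q)
    obtain ⟨r₂, hr₂⟩ := h₀.exists_adjoint hT₂ q
    refine ⟨r₁ + r₂, fun f => ?_⟩
    rw [mul_add, map_add, ← hr₁, ← hr₂, ← map_add]
    congr 1
    ring
  by_cases hG : ∃ q f, u₀ ((C a * X * T₁ f + T₂ f) * q) ≠ 0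
  · obtain ⟨q₂, f₀, hne⟩ := hG
    obtain ⟨m₀, hm₀⟩ := hex q₂
    obtain ⟨g₀, -, hg₀⟩ := hadj m₀ 0 (Submodule.zero_mem _) q₂ hm₀
    simp only [mul_zero, zero_add, map_zero, add_zero] at hg₀
    obtain ⟨r₀, hr₀⟩ := hadj₀ q₂
    have hg₀ne : g₀ ≠ 0 := by
      rintro rfl
      exact hne (by rw [hg₀, mul_zero, map_zero])
    have hT₁0 : T₁ = 0 := by
      refine LinearMap.ext fun f => hu₁.eq_zero fun q => ?_
      obtain ⟨m, hm⟩ := hex q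
      obtain ⟨g, -, hg⟩ := hadj m q hm 0 (Submodule.zero_mem _)
      simp only [add_zero] at hg
      obtain ⟨r, hr⟩ := hadj₀ (C a * X * q)
      obtain ⟨s, hs⟩ := h₁.exists_adjoint hT₁ q
      have hs0 : g₀ * s = 0 := by
        refine IsPearson.independent (r := g₀ * r - g * r₀) hb h₀ h₁ hu₁ fun f => ?_
        have e1 := hg (f * g₀)
        rw [hr, hs] at e1
        have e2 : u₀ (f * g * r₀) = u (f * g * g₀) := by rw [← hr₀, hg₀]
        rw [mul_sub, map_sub]
        simp only [mul_assoc] at e1 e2 ⊢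
        rw [mul_comm g g₀] at e2
        linear_combination e1 - e2
      have := (mul_eq_zero.1 hs0).resolve_left hg₀ne
      rw [mul_comm, hs, this, mul_zero, map_zero]
    refine ⟨hT₁0, eq_zero_of_apply_orthogonal_eq_zero hu hortho hspan hT₂ fun n => ?_⟩
    refine hu₀.definite _ ?_
    set q := conjPoly (T₂ (p (n + 1))) with hq
    have hqmem : q ∈ degreeLT ℂ (n + 2) := conjPoly_mem_degreeLT (hdeg₂ _ _ (hp (n + 1)))
    have hq₁ : C a⁻¹ * q.divX ∈ degreeLT ℂ (n + 1) := by
      rw [mem_degreeLT, degree_lt_iff_coeff_zero] at hqmem ⊢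
      intro j hj
      rw [coeff_C_mul, coeff_divX, hqmem (j + 1) (by omega), mul_zero]
    have hq₂ : C (q.coeff 0) ∈ degreeLT ℂ (n + 1) := by
      rw [mem_degreeLT]
      exact degree_C_le.trans_lt (by exact_mod_cast n.succ_pos)
    obtain ⟨g, hgm, hg⟩ := hadj (n + 1) _ hq₁ _ hq₂
    have hq' : C a * X * (C a⁻¹ * q.divX) + C (q.coeff 0) = q := by
      have : C a * C a⁻¹ = (1 : ℂ[X]) := by rw [← C_mul, mul_inv_cancel₀ ha, C_1]
      conv_rhs => rw [← divX_mul_X_add q]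
      linear_combination (X * q.divX) * this
    have := hg (p (n + 1))
    rw [hq', hT₁0, hortho _ _ hgm] at this
    simpa using this
  · push Not at hG
    have hG0 : ∀ f, C a * X * T₁ f + T₂ f = 0 := fun f =>
      hu₀.eq_zero fun q => by rw [mul_comm]; exact hG q f
    have hT₁0 : T₁ = 0 := by
      refine hspan _ fun n => ?_
      have hmem : T₁ (p n) ∈ degreeLT ℂ n := by
        have h2 := hdeg₂ _ _ (hp n)
        rw [mem_degreeLT, degree_lt_iff_coeff_zero] at h2 ⊢
        intro j hj
        have h3 := congrArg (fun f => f.coeff (j + 1)) (hG0 (p n))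
        simp only [coeff_add, mul_assoc, coeff_C_mul, coeff_X_mul, h2 (j + 1) (by omega),
          add_zero, coeff_zero] at h3
        exact (mul_eq_zero.1 h3).resolve_left ha
      obtain ⟨g, hgm, hg⟩ := hadj n _ (conjPoly_mem_degreeLT hmem) 0 (Submodule.zero_mem _)
      refine hu₁.definite _ ?_
      have := hg (p n)
      rwa [hG0, zero_mul, map_zero, zero_add, hortho _ _ hgm] at this
    refine ⟨hT₁0, LinearMap.ext fun f => ?_⟩
    have := hG0 f
    simpa [hT₁0] using this

end Vanishing

/-! ### Intertwining operators between scalar and `2 × 2` orthogonal polynomials -/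

/-- The bilinear form `u (v₀ w₀)` on vectors of length one. -/
def scalarForm (u : ℂ[X] →ₗ[ℂ] ℂ) : (Fin 1 → ℂ[X]) →ₗ[ℂ] (Fin 1 → ℂ[X]) →ₗ[ℂ] ℂ :=
  LinearMap.mk₂ ℂ (fun v w => u (v 0 * w 0))
    (fun v v' w => by simp [add_mul])
    (fun c v w => by simp)
    (fun v w w' => by simp [mul_add])
    (fun c v w => by simp)

lemma scalarForm_apply (u : ℂ[X] →ₗ[ℂ] ℂ) (v w : Fin 1 → ℂ[X]) :
    scalarForm u v w = u (v 0 * w 0) := rfl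

/-- The bilinear form `u₀ ((a x v₀ + v₁) (a x w₀ + w₁)) + u₁ (v₀ w₀)` on vectors of length two. -/
def hermiteForm (a : ℂ) (u₀ u₁ : ℂ[X] →ₗ[ℂ] ℂ) :
    (Fin 2 → ℂ[X]) →ₗ[ℂ] (Fin 2 → ℂ[X]) →ₗ[ℂ] ℂ :=
  LinearMap.mk₂ ℂ
    (fun v w => u₀ ((C a * X * v 0 + v 1) * (C a * X * w 0 + w 1)) + u₁ (v 0 * w 0))
    (fun v v' w => by
      have : (C a * X * (v + v') 0 + (v + v') 1) * (C a * X * w 0 + w 1) =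
          (C a * X * v 0 + v 1) * (C a * X * w 0 + w 1) +
            (C a * X * v' 0 + v' 1) * (C a * X * w 0 + w 1) := by
        simp only [Pi.add_apply]; ring
      rw [this, Pi.add_apply, add_mul (v 0), map_add, map_add]; ring)
    (fun c v w => by
      have : (C a * X * (c • v) 0 + (c • v) 1) * (C a * X * w 0 + w 1) =
          c • ((C a * X * v 0 + v 1) * (C a * X * w 0 + w 1)) := by
        simp only [Pi.smul_apply, smul_eq_C_mul]; ring
      rw [this, Pi.smul_apply, smul_mul_assoc, map_smul, map_smul, smul_add])
    (fun v w w' => by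
      have : (C a * X * v 0 + v 1) * (C a * X * (w + w') 0 + (w + w') 1) =
          (C a * X * v 0 + v 1) * (C a * X * w 0 + w 1) +
            (C a * X * v 0 + v 1) * (C a * X * w' 0 + w' 1) := by
        simp only [Pi.add_apply]; ring
      rw [this, Pi.add_apply, mul_add (v 0), map_add, map_add]; ring)
    (fun c v w => by
      have : (C a * X * v 0 + v 1) * (C a * X * (c • w) 0 + (c • w) 1) =
          c • ((C a * X * v 0 + v 1) * (C a * X * w 0 + w 1)) := by
        simp only [Pi.smul_apply, smul_eq_C_mul]; ring
      rw [this, Pi.smul_apply, mul_smul_comm, map_smul, map_smul, smul_add])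

lemma hermiteForm_apply (a : ℂ) (u₀ u₁ : ℂ[X] →ₗ[ℂ] ℂ) (v w : Fin 2 → ℂ[X]) :
    hermiteForm a u₀ u₁ v w =
      u₀ ((C a * X * v 0 + v 1) * (C a * X * w 0 + w 1)) + u₁ (v 0 * w 0) := rfl

lemma hermiteForm_comm (a : ℂ) (u₀ u₁ : ℂ[X] →ₗ[ℂ] ℂ) (v w : Fin 2 → ℂ[X]) :
    hermiteForm a u₀ u₁ v w = hermiteForm a u₀ u₁ w v := by
  rw [hermiteForm_apply, hermiteForm_apply, mul_comm (C a * X * v 0 + v 1), mul_comm (v 0)]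

lemma hermiteForm_X_smul (a : ℂ) (u₀ u₁ : ℂ[X] →ₗ[ℂ] ℂ) (v w : Fin 2 → ℂ[X]) :
    hermiteForm a u₀ u₁ ((X : ℂ[X]) • v) w = hermiteForm a u₀ u₁ v ((X : ℂ[X]) • w) := by
  simp only [hermiteForm_apply, Pi.smul_apply, smul_eq_mul]
  congr 2 <;> ring

lemma IsDiffOp.comp_proj {N k : ℕ} {T : ℂ[X] →ₗ[ℂ] Fin N → ℂ[X]} (hT : IsDiffOp k T) (i : Fin N) :
    IsDiffOp k (LinearMap.proj i ∘ₗ T) := by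
  induction k generalizing T with
  | zero => rw [isDiffOp_zero] at hT ⊢; rw [hT]; rfl
  | succ k ih => exact ih (isDiffOp_succ.1 hT)

lemma IsDiffOp.adjoint {a : ℂ} {u u₀ u₁ : ℂ[X] →ₗ[ℂ] ℂ} {k : ℕ}
    {S : (Fin 2 → ℂ[X]) →ₗ[ℂ] ℂ[X]} {T : ℂ[X] →ₗ[ℂ] Fin 2 → ℂ[X]}
    (hdef : ∀ w, (∀ v, hermiteForm a u₀ u₁ v w = 0) → w = 0) (hS : IsDiffOp k S)
    (h : ∀ v q, u (S v * q) = hermiteForm a u₀ u₁ v (T q)) : IsDiffOp k T := by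
  induction k generalizing S T with
  | zero =>
    rw [isDiffOp_zero] at hS ⊢
    refine LinearMap.ext fun q => hdef _ fun v => ?_
    rw [← h, hS]; simp
  | succ k ih =>
    have hS' : IsDiffOp k (commX (-S)) := by
      have hneg : ∀ (j : ℕ) (R : (Fin 2 → ℂ[X]) →ₗ[ℂ] ℂ[X]), IsDiffOp j R → IsDiffOp j (-R) := by
        intro j
        induction j with
        | zero => intro R hR; rw [isDiffOp_zero] at hR ⊢; rw [hR, neg_zero]
        | succ j ihj =>
          intro R hR
          have : commX (-R) = -commX R := by
            refine LinearMap.ext fun v => ?_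
            simp only [commX_apply, LinearMap.neg_apply, smul_neg]; abel
          rw [isDiffOp_succ, this]
          exact ihj _ hR
      exact hneg _ _ hS
    refine ih (T := commX T) hS' fun v q => ?_
    rw [commX_apply, commX_apply, map_sub, ← hermiteForm_X_smul, ← h, ← h, ← map_sub]
    congr 1
    simp only [LinearMap.neg_apply, smul_eq_mul]
    ring

section Intertwining

variable {a b : ℂ} {u u₀ u₁ : ℂ[X] →ₗ[ℂ] ℂ} {p : ℕ → Fin 1 → Fin 1 → ℂ[X]}
  {P : ℕ → Fin 2 → Fin 2 → ℂ[X]} {k : ℕ}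

namespace IsOrthoSeq

lemma scalar_mem (hp : IsOrthoSeq (scalarForm u) p) (n : ℕ) : p n 0 0 ∈ degreeLT ℂ (n + 1) :=
  mem_vecDegreeLT.1 (hp.simple.row_mem n 0) 0

lemma scalar_apply_eq_zero (hp : IsOrthoSeq (scalarForm u) p) (n : ℕ) (g : ℂ[X])
    (hg : g ∈ degreeLT ℂ n) : u (p n 0 0 * g) = 0 :=
  hp.apply_eq_zero (v := fun _ => g) 0 (mem_vecDegreeLT.2 fun _ => hg)

lemma scalar_ext (hp : IsOrthoSeq (scalarForm u) p) {M : Type*} [AddCommGroup M] [Module ℂ M]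
    {f g : ℂ[X] →ₗ[ℂ] M} (h : ∀ n, f (p n 0 0) = g (p n 0 0)) : f = g := by
  have := hp.simple.linearMap_ext (f := f ∘ₗ LinearMap.proj 0) (g := g ∘ₗ LinearMap.proj 0)
    fun n i => by rw [Subsingleton.elim i 0]; exact h n
  exact LinearMap.ext fun q => LinearMap.congr_fun this fun _ => q

lemma scalar_mem_span (hp : IsOrthoSeq (scalarForm u) p) {m : ℕ} {q : ℂ[X]}
    (hq : q ∈ degreeLT ℂ m) : q ∈ Submodule.span ℂ {r | ∃ n < m, p n 0 0 = r} := by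
  have h := Submodule.mem_map_of_mem (f := LinearMap.proj (R := ℂ) (φ := fun _ : Fin 1 => ℂ[X]) 0)
    (hp.simple.mem_span (v := fun _ => q) (mem_vecDegreeLT.2 fun _ => hq))
  rw [Submodule.map_span] at h
  refine Submodule.span_mono ?_ h
  rintro _ ⟨_, ⟨n, hn, i, rfl⟩, rfl⟩
  exact ⟨n, hn, by rw [Subsingleton.elim i 0]; rfl⟩

end IsOrthoSeq

/-- Every operator intertwining scalar orthogonal polynomials with those of the Hermite type
form vanishes. -/
theorem eq_zero_of_scalar_intertwines (ha : a ≠ 0) (hb : b ≠ 0) (hu : IsPosFunctional u)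
    (hu₀ : IsPosFunctional u₀) (hu₁ : IsPosFunctional u₁) (h₀ : IsPearson 0 u₀)
    (h₁ : IsPearson b u₁) (hp : IsOrthoSeq (scalarForm u) p)
    (hP : IsOrthoSeq (hermiteForm a u₀ u₁) P) {T : ℂ[X] →ₗ[ℂ] Fin 2 → ℂ[X]}
    (hT : ∀ i, IsDiffOp k (LinearMap.proj i ∘ₗ T))
    (h : ∀ n, ∃ A : Fin 2 → ℂ, T (p n 0 0) = ∑ i, A i • P n i) : T = 0 := by
  choose A hA using h
  have hdeg : ∀ m, ∀ q ∈ degreeLT ℂ m, T q ∈ vecDegreeLT 2 m := by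
    intro m q hq
    have hle : Submodule.span ℂ {r | ∃ n < m, p n 0 0 = r} ≤ (vecDegreeLT 2 m).comap T := by
      refine Submodule.span_le.2 ?_
      rintro _ ⟨n, hn, rfl⟩
      change T (p n 0 0) ∈ vecDegreeLT 2 m
      rw [hA, ← hP.simple.span_eq]
      exact Submodule.sum_mem _ fun i _ => Submodule.smul_mem _ _
        (Submodule.subset_span ⟨n, hn, i, rfl⟩)
    exact hle (hp.scalar_mem_span hq)
  obtain ⟨h1, h2⟩ := pair_eq_zero ha hb hu hu₀ hu₁ h₀ h₁ hp.scalar_mem hp.scalar_apply_eq_zero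
    (fun T hT => hp.scalar_ext (g := 0) hT) (hT 0) (hT 1)
    (fun m q hq => mem_vecDegreeLT.1 (hdeg m q hq) 1) (by
      intro m q₁ hq₁ q₂ hq₂
      have hq : ![q₁, q₂] ∈ vecDegreeLT 2 m := by
        rw [mem_vecDegreeLT, Fin.forall_fin_two]; exact ⟨hq₁, hq₂⟩
      obtain ⟨g, hg, hg'⟩ := hp.exists_repr (m := m)
        ((hermiteForm a u₀ u₁).flip ![q₁, q₂] ∘ₗ T ∘ₗ LinearMap.proj 0) fun n hn i => by
          rw [Subsingleton.elim i 0]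
          simp only [LinearMap.comp_apply, LinearMap.proj_apply, hA, map_sum, map_smul]
          refine Finset.sum_eq_zero fun j _ => ?_
          rw [LinearMap.flip_apply, hP.apply_eq_zero j, smul_zero]
          exact mem_vecDegreeLT.2 fun l => degreeLT_mono hn (mem_vecDegreeLT.1 hq l)
      exact ⟨g 0, mem_vecDegreeLT.1 hg 0, fun f => hg' fun _ => f⟩)
  refine LinearMap.ext fun q => funext fun i => ?_
  fin_cases i
  · exact LinearMap.congr_fun h1 q
  · exact LinearMap.congr_fun h2 q

/-- Every operator intertwining the orthogonal polynomials of the Hermite type form with scalar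
ones vanishes. -/
theorem eq_zero_of_intertwines_scalar (ha : a ≠ 0) (hb : b ≠ 0) (hu : IsPosFunctional u)
    (hu₀ : IsPosFunctional u₀) (hu₁ : IsPosFunctional u₁) (h₀ : IsPearson 0 u₀)
    (h₁ : IsPearson b u₁) (hp : IsOrthoSeq (scalarForm u) p)
    (hP : IsOrthoSeq (hermiteForm a u₀ u₁) P) {S : (Fin 2 → ℂ[X]) →ₗ[ℂ] ℂ[X]}
    (hS : IsDiffOp k S) (h : ∀ n i, ∃ c : ℂ, S (P n i) = c • p n 0 0) : S = 0 := by
  choose c hc using h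
  have hdef : ∀ w, (∀ v, hermiteForm a u₀ u₁ v w = 0) → w = 0 := fun w hw =>
    hP.definite w (by rw [hermiteForm_comm]; exact hw _)
  let L : ℂ[X] →ₗ[ℂ] Module.Dual ℂ (Fin 2 → ℂ[X]) :=
    { toFun := fun q => u ∘ₗ LinearMap.mulRight ℂ q ∘ₗ S
      map_add' := fun q r => by ext; simp [mul_add]
      map_smul' := fun t q => by ext; simp }
  have hL : ∀ v q, L q v = u (S v * q) := fun _ _ => rfl
  have hrepr : ∀ m, ∀ q ∈ degreeLT ℂ m, ∃ g ∈ vecDegreeLT 2 m, ∀ v,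
      L q v = hermiteForm a u₀ u₁ v g := fun m q hq =>
    hP.exists_repr (L q) fun n hn i => by
      rw [hL, hc, smul_mul_assoc, map_smul,
        hp.scalar_apply_eq_zero n q (degreeLT_mono hn hq), smul_zero]
  have hex : ∀ q : ℂ[X], ∃ m, q ∈ degreeLT ℂ m := fun q => ⟨q.natDegree + 1, by
    rw [mem_degreeLT]
    exact degree_le_natDegree.trans_lt (by exact_mod_cast Nat.lt_succ_self _)⟩
  have hinj : Function.Injective (hermiteForm a u₀ u₁).flip := by
    rw [← LinearMap.ker_eq_bot, LinearMap.ker_eq_bot']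
    exact fun w hw => hdef w fun v => LinearMap.congr_fun hw v
  have hrange : ∀ q, L q ∈ LinearMap.range (hermiteForm a u₀ u₁).flip := fun q => by
    obtain ⟨m, hm⟩ := hex q
    obtain ⟨g, -, hg⟩ := hrepr m q hm
    exact ⟨g, LinearMap.ext fun v => (hg v).symm⟩
  let T : ℂ[X] →ₗ[ℂ] Fin 2 → ℂ[X] :=
    (LinearEquiv.ofInjective _ hinj).symm.toLinearMap ∘ₗ L.codRestrict _ hrange
  have hadj : ∀ v q, u (S v * q) = hermiteForm a u₀ u₁ v (T q) := fun v q => by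
    have h1 : (hermiteForm a u₀ u₁).flip (T q) = L q :=
      congrArg Subtype.val ((LinearEquiv.ofInjective _ hinj).apply_symm_apply
        (L.codRestrict _ hrange q))
    rw [← LinearMap.flip_apply, h1, hL]
  have hT : IsDiffOp k T := hS.adjoint hdef hadj
  have hTdeg : ∀ m, ∀ q ∈ degreeLT ℂ m, T q ∈ vecDegreeLT 2 m := fun m q hq => by
    obtain ⟨g, hg, hg'⟩ := hrepr m q hq
    have : T q = g := sub_eq_zero.1 (hdef _ fun v => by
      rw [map_sub, ← hadj, ← hg', hL, sub_self])
    rwa [this]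
  have hSdeg : ∀ m, ∀ v ∈ vecDegreeLT 2 m, S v ∈ degreeLT ℂ m := fun m v hv => by
    have hle : Submodule.span ℂ {r | ∃ n < m, ∃ i, P n i = r} ≤ (degreeLT ℂ m).comap S := by
      refine Submodule.span_le.2 ?_
      rintro _ ⟨n, hn, i, rfl⟩
      change S (P n i) ∈ degreeLT ℂ m
      rw [hc]
      exact Submodule.smul_mem _ _ (degreeLT_mono (by omega : n + 1 ≤ m) (hp.scalar_mem n))
    exact hle (hP.simple.mem_span hv)
  obtain ⟨h1, h2⟩ := pair_eq_zero ha hb hu hu₀ hu₁ h₀ h₁ hp.scalar_mem hp.scalar_apply_eq_zero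
    (fun T hT => hp.scalar_ext (g := 0) hT) (hT.comp_proj 0) (hT.comp_proj 1)
    (fun m q hq => mem_vecDegreeLT.1 (hTdeg m q hq) 1) (by
      intro m q₁ hq₁ q₂ hq₂
      have hq : ![q₁, q₂] ∈ vecDegreeLT 2 m := by
        rw [mem_vecDegreeLT, Fin.forall_fin_two]; exact ⟨hq₁, hq₂⟩
      refine ⟨S ![q₁, q₂], hSdeg m _ hq, fun f => ?_⟩
      rw [mul_comm f, hadj, hermiteForm_comm, hermiteForm_apply]
      rfl)
  have hT0 : T = 0 := by
    refine LinearMap.ext fun q => funext fun i => ?_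
    fin_cases i
    · exact LinearMap.congr_fun h1 q
    · exact LinearMap.congr_fun h2 q
  refine LinearMap.ext fun v => hu.eq_zero fun q => ?_
  rw [mul_comm, hadj, hT0, LinearMap.zero_apply, map_zero]

end Intertwining

/-! ### Row operators of matrix differential operators -/

/-- The action of a matrix differential operator on row vectors. -/
def MatDiffOp.rowAct {n m : ℕ} (T : MatDiffOp n m) : (Fin n → ℂ[X]) →ₗ[ℂ] Fin m → ℂ[X] :=
  LinearMap.pi fun l =>
    ∑ i, diffSum (T.order + 1) (fun j => T.coeff j i l) ∘ₗ LinearMap.proj i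

lemma MatDiffOp.rowAct_apply {n m : ℕ} (T : MatDiffOp n m) (v : Fin n → ℂ[X]) (l : Fin m) :
    T.rowAct v l = ∑ i, diffSum (T.order + 1) (fun j => T.coeff j i l) (v i) := by
  simp [MatDiffOp.rowAct]

lemma MatDiffOp.act_apply {k n m : ℕ} (P : MatPoly k n) (T : MatDiffOp n m) (i : Fin k) :
    MatDiffOp.act P T i = T.rowAct (P i) := by
  funext l
  rw [MatDiffOp.rowAct_apply]
  simp only [MatDiffOp.act, Matrix.sum_apply, Matrix.mul_apply, diffSum_apply, derivM,
    Matrix.of_apply]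
  exact Finset.sum_comm

lemma MatDiffOp.coeff_eq_zero_of_rowAct {n m : ℕ} {T : MatDiffOp n m} (h : T.rowAct = 0) (j : ℕ) :
    T.coeff j = 0 := by
  rcases lt_or_ge T.order j with hj | hj
  · exact T.coeff_eq_zero j hj
  ext1 i l
  refine diffSum_injective (k := T.order + 1) (F := fun j => T.coeff j i l) ?_ j (by omega)
  refine LinearMap.ext fun q => ?_
  have h1 := congrFun (LinearMap.congr_fun h (Pi.single i q)) l
  rw [MatDiffOp.rowAct_apply, Finset.sum_eq_single i] at h1
  · simpa using h1
  · intro i' _ hi'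
    rw [Pi.single_eq_of_ne hi', map_zero]
  · simp

lemma isDiffOp_sum_comp_proj {n k : ℕ} (F : Fin n → ℕ → ℂ[X]) :
    IsDiffOp k (∑ i, diffSum k (F i) ∘ₗ LinearMap.proj (R := ℂ) (φ := fun _ => ℂ[X]) i) := by
  induction k generalizing F with
  | zero => simp [isDiffOp_zero, diffSum]
  | succ k ih =>
    rw [isDiffOp_succ]
    convert ih fun i j => ((j : ℂ[X]) + 1) * F i (j + 1) using 1
    refine LinearMap.ext fun v => ?_
    simp only [commX_apply, LinearMap.sum_apply, LinearMap.comp_apply, LinearMap.proj_apply,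
      Pi.smul_apply, Finset.smul_sum, ← Finset.sum_sub_distrib, ← commX_diffSum]

lemma cmap_mul_apply {k n m : ℕ} (A : Matrix (Fin k) (Fin n) ℂ) (P : MatPoly n m) (i : Fin k) :
    (cmap A * P) i = ∑ j, A i j • P j := by
  funext l
  simp [Matrix.mul_apply, cmap, smul_eq_C_mul]

/-! ### Moment functionals -/

lemma integrable_eval_mul {f : ℝ → ℂ} (hf : ∀ k : ℕ, Integrable fun x : ℝ => (x : ℂ) ^ k * f x)
    (p : ℂ[X]) : Integrable fun x : ℝ => p.eval (x : ℂ) * f x := by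
  induction p using Polynomial.induction_on' with
  | add p q hp hq =>
    simp only [eval_add, add_mul]
    exact hp.add hq
  | monomial n c =>
    simp only [eval_monomial, mul_assoc]
    exact (hf n).const_mul c

/-- The functional `p ↦ ∫ p(x) f(x) dx` on polynomials. -/
def momentFunctional (f : ℝ → ℂ) (hf : ∀ k : ℕ, Integrable fun x : ℝ => (x : ℂ) ^ k * f x) :
    ℂ[X] →ₗ[ℂ] ℂ where
  toFun p := ∫ x : ℝ, p.eval (x : ℂ) * f x
  map_add' p q := by
    simp only [eval_add, add_mul]
    exact integral_add (integrable_eval_mul hf p) (integrable_eval_mul hf q)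
  map_smul' c p := by
    simp only [eval_smul, smul_eq_mul, mul_assoc, RingHom.id_apply]
    exact integral_const_mul _ _

section

variable {f : ℝ → ℂ} {hf : ∀ k : ℕ, Integrable fun x : ℝ => (x : ℂ) ^ k * f x}

lemma momentFunctional_apply (p : ℂ[X]) :
    momentFunctional f hf p = ∫ x : ℝ, p.eval (x : ℂ) * f x := rfl

lemma isPosFunctional_momentFunctional (hpos : ∀ᵐ x, 0 < f x) :
    IsPosFunctional (momentFunctional f hf) := by
  have key : ∀ p : ℂ[X], ∀ᵐ x : ℝ, (p * conjPoly p).eval (x : ℂ) * f x =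
      ((Complex.normSq (p.eval (x : ℂ)) * (f x).re : ℝ) : ℂ) := fun p => by
    filter_upwards [hpos] with x hx
    have hre : f x = ((f x).re : ℂ) := Complex.ext rfl (by simpa using (Complex.lt_def.1 hx).2.symm)
    rw [eval_mul, eval_conjPoly, Complex.star_def, Complex.mul_conj, hre]
    push_cast [Complex.ofReal_re]
    rfl
  have hval : ∀ p : ℂ[X], momentFunctional f hf (p * conjPoly p) =
      ((∫ x : ℝ, Complex.normSq (p.eval (x : ℂ)) * (f x).re : ℝ) : ℂ) := fun p => by
    rw [momentFunctional_apply, integral_congr_ae (key p)]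
    exact integral_ofReal
  have hnn : ∀ p : ℂ[X], 0 ≤ᵐ[volume] fun x : ℝ =>
      Complex.normSq (p.eval (x : ℂ)) * (f x).re := fun p => by
    filter_upwards [hpos] with x hx
    exact mul_nonneg (Complex.normSq_nonneg _) (Complex.lt_def.1 hx).1.le
  refine ⟨fun p => ?_, fun p hp => ?_⟩
  · rw [hval]
    exact_mod_cast integral_nonneg_of_ae (hnn p)
  · have hint : Integrable fun x : ℝ => Complex.normSq (p.eval (x : ℂ)) * (f x).re := by
      have h1 := ((integrable_eval_mul hf (p * conjPoly p)).congr (key p)).re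
      simpa using h1
    rw [hval, Complex.ofReal_eq_zero, integral_eq_zero_iff_of_nonneg_ae (hnn p) hint] at hp
    have hzero : (fun x : ℝ => p.eval (x : ℂ)) =ᵐ[volume] fun _ => 0 := by
      filter_upwards [hp, hpos] with x hx hx'
      rcases mul_eq_zero.1 hx with h | h
      · exact Complex.normSq_eq_zero.1 h
      · exact absurd h (Complex.lt_def.1 hx').1.ne'
    have hall := (Continuous.ae_eq_iff_eq volume (by fun_prop) continuous_const).1 hzero
    refine Polynomial.eq_zero_of_infinite_isRoot p ?_
    refine (Set.infinite_range_of_injective Complex.ofReal_injective).mono ?_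
    rintro _ ⟨x, rfl⟩
    exact congrFun hall x

end

/-! ### Gaussian weights -/

/-- The Gaussian weight `e^{-x²} e^{2bx}`. -/
def gaussianWeight (b x : ℝ) : ℂ := Complex.exp (-(x : ℂ) ^ 2) * Complex.exp (2 * (b : ℂ) * (x : ℂ))

lemma gaussianWeight_zero (x : ℝ) : gaussianWeight 0 x = Complex.exp (-(x : ℂ) ^ 2) := by
  simp [gaussianWeight]

lemma gaussianWeight_eq (b x : ℝ) :
    gaussianWeight b x = Complex.exp ((b : ℂ) ^ 2) * gaussianWeight 0 (x - b) := by
  rw [gaussianWeight_zero, gaussianWeight, ← Complex.exp_add, ← Complex.exp_add]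
  congr 1
  push_cast
  ring

lemma gaussianWeight_pos (b x : ℝ) : 0 < gaussianWeight b x := by
  have : gaussianWeight b x = ((Real.exp (-x ^ 2) * Real.exp (2 * b * x) : ℝ) : ℂ) := by
    simp [gaussianWeight]
  rw [this]
  exact_mod_cast (by positivity : 0 < Real.exp (-x ^ 2) * Real.exp (2 * b * x))

lemma integrable_pow_mul_gaussianWeight (b : ℝ) (k : ℕ) :
    Integrable fun x : ℝ => (x : ℂ) ^ k * gaussianWeight b x := by
  have h0 : ∀ k : ℕ, Integrable fun x : ℝ => (x : ℂ) ^ k * gaussianWeight 0 x := fun k => by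
    have h := (integrable_rpow_mul_exp_neg_mul_sq (b := 1) one_pos (s := k)
      (by linarith [(Nat.cast_nonneg k : (0 : ℝ) ≤ k)])).ofReal (𝕜 := ℂ)
    refine h.congr (Eventually.of_forall fun x => ?_)
    simp [gaussianWeight_zero]
  have h := ((integrable_eval_mul h0 ((X + C (b : ℂ)) ^ k)).comp_sub_right b).const_mul
    (Complex.exp ((b : ℂ) ^ 2))
  refine h.congr (Eventually.of_forall fun x => ?_)
  simp only [gaussianWeight_eq b x, eval_pow, eval_add, eval_X, eval_C, Complex.ofReal_sub,
    sub_add_cancel]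
  ring

/-- The moment functional of the Gaussian weight `e^{-x²} e^{2bx}`. -/
def gaussianFunctional (b : ℝ) : ℂ[X] →ₗ[ℂ] ℂ :=
  momentFunctional (gaussianWeight b) (integrable_pow_mul_gaussianWeight b)

lemma isPosFunctional_gaussianFunctional (b : ℝ) : IsPosFunctional (gaussianFunctional b) :=
  isPosFunctional_momentFunctional (Eventually.of_forall (gaussianWeight_pos b))

lemma isPearson_gaussianFunctional (b : ℝ) : IsPearson (b : ℂ) (gaussianFunctional b) := by
  intro p
  have hint := integrable_eval_mul (integrable_pow_mul_gaussianWeight b)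
  have hweight : ∀ x : ℝ, HasDerivAt (gaussianWeight b)
      (-(2 * (x : ℂ) - 2 * b) * gaussianWeight b x) x := fun x => by
    have h1 : HasDerivAt (fun y : ℂ => Complex.exp (-y ^ 2) * Complex.exp (2 * (b : ℂ) * y))
        (-(2 * (x : ℂ) - 2 * b) * gaussianWeight b x) (x : ℂ) := by
      refine (((hasDerivAt_pow 2 (x : ℂ)).fun_neg.cexp).fun_mul
        (((hasDerivAt_id' (x : ℂ)).const_mul (2 * (b : ℂ))).cexp)).congr_deriv ?_
      simp only [gaussianWeight]
      norm_num
      ring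
    exact h1.comp_ofReal
  have hderiv : ∀ x : ℝ, HasDerivAt (fun x : ℝ => p.eval (x : ℂ) * gaussianWeight b x)
      ((derivative p - (2 * X - 2 * C (b : ℂ)) * p).eval (x : ℂ) * gaussianWeight b x) x :=
    fun x => by
      refine ((p.hasDerivAt (x : ℂ)).comp_ofReal.fun_mul (hweight x)).congr_deriv ?_
      simp only [eval_sub, eval_mul, eval_X, eval_C, eval_ofNat]
      ring
  rw [← sub_eq_zero, ← map_sub]
  exact integral_eq_zero_of_hasDerivAt_of_integrable hderiv (hint _) (hint _)

/-! ### Orthogonal polynomials as orthogonal sequences of bilinear forms -/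

lemma IsMOP.isSimpleSeq {s : Set ℝ} {N : ℕ} {W : ℝ → Matrix (Fin N) (Fin N) ℂ}
    {P : ℕ → MatPoly N N} (hP : IsMOP s W P) : IsSimpleSeq P :=
  ⟨hP.degree_le, hP.lead_unit⟩

lemma IsMOP.isOrthoSeq_scalarForm {w : ℝ → Matrix (Fin 1) (Fin 1) ℂ}
    {hf : ∀ k : ℕ, Integrable fun x : ℝ => (x : ℂ) ^ k * w x 0 0}
    (hpos : IsPosFunctional (momentFunctional (fun x => w x 0 0) hf))
    {p : ℕ → MatPoly 1 1} (hp : IsMOP Set.univ w p) :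
    IsOrthoSeq (scalarForm (momentFunctional (fun x => w x 0 0) hf)) p where
  simple := hp.isSimpleSeq
  definite v hv := by
    funext i
    rw [Subsingleton.elim i 0]
    exact hpos.definite _ hv
  ortho n m hnm i k := by
    have h := congrFun (congrFun (hp.orthogonal n m hnm) i) k
    simp only [innerW, Matrix.of_apply, Matrix.zero_apply, setIntegral_univ] at h
    rw [scalarForm_apply, momentFunctional_apply, ← h]
    refine integral_congr_ae (Eventually.of_forall fun x => ?_)
    simp only [Matrix.mul_apply, Fin.sum_univ_one, Matrix.conjTranspose_apply, evalM,
      Matrix.of_apply, eval_mul, eval_conjPoly]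
    ring

lemma IsMOP.isOrthoSeq_hermiteForm {a b : ℝ} {P : ℕ → MatPoly 2 2}
    (hP : IsMOP Set.univ
      (fun x : ℝ => Complex.exp (-(x : ℂ) ^ 2) •
        !![(a : ℂ) ^ 2 * (x : ℂ) ^ 2 + Complex.exp (2 * (b : ℂ) * (x : ℂ)), (a : ℂ) * (x : ℂ);
           (a : ℂ) * (x : ℂ), 1]) P) :
    IsOrthoSeq (hermiteForm (a : ℂ) (gaussianFunctional 0) (gaussianFunctional b)) P where
  simple := hP.isSimpleSeq
  definite v hv := by
    have hconj : C (a : ℂ) * X * conjPoly (v 0) + conjPoly (v 1) =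
        conjPoly (C (a : ℂ) * X * v 0 + v 1) := by
      simp [conjPoly]
    rw [hermiteForm_apply, hconj] at hv
    have h0 := isPosFunctional_gaussianFunctional 0
    have h1 := isPosFunctional_gaussianFunctional b
    have hz := (add_eq_zero_iff_of_nonneg (h0.nonneg _) (h1.nonneg _)).1 hv
    have hv0 := h1.definite _ hz.2
    have hv1 := h0.definite _ hz.1
    rw [hv0, mul_zero, zero_add] at hv1
    funext i
    fin_cases i
    · exact hv0
    · exact hv1
  ortho n m hnm i k := by
    have h := congrFun (congrFun (hP.orthogonal n m hnm) i) k
    simp only [innerW, Matrix.of_apply, Matrix.zero_apply, setIntegral_univ] at h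
    rw [hermiteForm_apply, gaussianFunctional, gaussianFunctional, momentFunctional_apply,
      momentFunctional_apply, ← integral_add
        (integrable_eval_mul (integrable_pow_mul_gaussianWeight 0) _)
        (integrable_eval_mul (integrable_pow_mul_gaussianWeight b) _), ← h]
    refine integral_congr_ae (Eventually.of_forall fun x => ?_)
    simp only [Matrix.mul_apply, Fin.sum_univ_two, Matrix.conjTranspose_apply, evalM,
      Matrix.of_apply, eval_mul, eval_add, eval_C, eval_X, eval_conjPoly, gaussianWeight,
      Complex.ofReal_zero, mul_zero, zero_mul, Complex.exp_zero, mul_one, Matrix.smul_apply, smul_eq_mul, Matrix.cons_val', Matrix.cons_val_zero,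
      Matrix.cons_val_one, Matrix.cons_val_fin_one]
    ring

/-- for the singular 2×2 Hermite-type weight, the modules `𝒟(w, W)` and
`𝒟(W, w)` vanish for every good-enough scalar weight `w` on `ℝ`. -/
theorem statement_12 (a b : ℝ) (ha : a ≠ 0) (hb : b ≠ 0)
    (w : ℝ → Matrix (Fin 1) (Fin 1) ℂ)
    (hw : IsWeight Set.univ w) (hwgood : GoodEnough Set.univ w)
    (p : ℕ → MatPoly 1 1) (hp : IsMOP Set.univ w p)
    (P : ℕ → MatPoly 2 2)
    (hP : IsMOP Set.univ
      (fun x : ℝ => Complex.exp (-(x : ℂ) ^ 2) •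
        !![(a : ℂ) ^ 2 * (x : ℂ) ^ 2 + Complex.exp (2 * (b : ℂ) * (x : ℂ)), (a : ℂ) * (x : ℂ);
           (a : ℂ) * (x : ℂ), 1]) P) :
    (∀ T : MatDiffOp 1 2,
      (∀ n, ∃ A : Matrix (Fin 1) (Fin 2) ℂ, MatDiffOp.act (p n) T = cmap A * P n) →
      ∀ j, T.coeff j = 0) ∧
    (∀ S : MatDiffOp 2 1,
      (∀ n, ∃ B : Matrix (Fin 2) (Fin 1) ℂ, MatDiffOp.act (P n) S = cmap B * p n) →
      ∀ j, S.coeff j = 0) := by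
  have ha' : (a : ℂ) ≠ 0 := Complex.ofReal_ne_zero.2 ha
  have hb' : (b : ℂ) ≠ 0 := Complex.ofReal_ne_zero.2 hb
  have hf : ∀ k : ℕ, Integrable fun x : ℝ => (x : ℂ) ^ k * w x 0 0 := fun k => by
    simpa using hw.moments k 0 0
  have hwpos : ∀ᵐ x, 0 < w x 0 0 := by
    have h := hw.posdef
    rw [Measure.restrict_univ] at h
    filter_upwards [h] with x hx using hx.diag_pos
  have hu := isPosFunctional_momentFunctional (hf := hf) hwpos
  have hp' := hp.isOrthoSeq_scalarForm hu
  have hP' := hP.isOrthoSeq_hermiteForm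
  have hu₀ := isPosFunctional_gaussianFunctional 0
  have hu₁ := isPosFunctional_gaussianFunctional b
  have h₀ : IsPearson 0 (gaussianFunctional 0) := by
    simpa using isPearson_gaussianFunctional 0
  have h₁ := isPearson_gaussianFunctional b
  refine ⟨fun T hT => MatDiffOp.coeff_eq_zero_of_rowAct ?_,
    fun S hS => MatDiffOp.coeff_eq_zero_of_rowAct ?_⟩
  · let ι : ℂ[X] →ₗ[ℂ] Fin 1 → ℂ[X] := LinearMap.pi fun _ => LinearMap.id
    have hι : ∀ v : Fin 1 → ℂ[X], ι (v 0) = v := fun v =>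
      funext fun i => by rw [Subsingleton.elim i 0]; rfl
    have hzero : T.rowAct ∘ₗ ι = 0 := by
      refine eq_zero_of_scalar_intertwines (k := T.order + 1) ha' hb' hu hu₀ hu₁ h₀ h₁ hp' hP'
        (fun i => ?_) fun n => ?_
      · convert isDiffOp_diffSum (T.order + 1) fun j => T.coeff j 0 i using 1
        refine LinearMap.ext fun q => ?_
        simp [MatDiffOp.rowAct_apply, ι]
      · obtain ⟨A, hA⟩ := hT n
        refine ⟨A 0, ?_⟩
        rw [LinearMap.comp_apply, hι, ← MatDiffOp.act_apply, hA, cmap_mul_apply]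
    refine LinearMap.ext fun v => ?_
    rw [← hι v]
    exact LinearMap.congr_fun hzero (v 0)
  · have hzero : LinearMap.proj 0 ∘ₗ S.rowAct = 0 := by
      refine eq_zero_of_intertwines_scalar (k := S.order + 1) ha' hb' hu hu₀ hu₁ h₀ h₁ hp' hP'
        ?_ fun n i => ?_
      · exact isDiffOp_sum_comp_proj fun i j => S.coeff j i 0
      · obtain ⟨B, hB⟩ := hS n
        refine ⟨B i 0, ?_⟩
        rw [LinearMap.comp_apply, ← MatDiffOp.act_apply, hB, cmap_mul_apply]
        simp
    refine LinearMap.ext fun v => funext fun i => ?_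
    rw [Subsingleton.elim i 0]
    exact LinearMap.congr_fun hzero v
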